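/- The permanent of any n×n doubly stochastic matrix is at least n!/n^n. -/

import Mathlib

open Finset

/-- The permanent of a square real matrix. -/
def permanent {n : ℕ} (A : Matrix (Fin n) (Fin n) ℝ) : ℝ :=
  ∑ σ : Equiv.Perm (Fin n), ∏ i, A i (σ i)

namespace MvPolynomial

variable {σ : Type*}

/-- The derivation on real polynomials given by the derivative in the direction `a`. -/
noncomputable def directionalDeriv (a : σ → ℝ) :
    Derivation ℝ (MvPolynomial σ ℝ) (MvPolynomial σ ℝ) :=
  mkDerivation ℝ fun i => C (a i)

/-- The restriction of a real polynomial to the line `t ↦ w + t a`. -/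
noncomputable def onLine {K : Type*} [CommRing K] [Algebra ℝ K] (w a : σ → K) :
    MvPolynomial σ ℝ →ₐ[ℝ] Polynomial K :=
  aeval fun i => Polynomial.C (w i) + Polynomial.X * Polynomial.C (a i)

theorem eval_onLine {K : Type*} [CommRing K] [Algebra ℝ K] (w a : σ → K)
    (g : MvPolynomial σ ℝ) (z : K) :
    (onLine w a g).eval z = aeval (fun i => w i + z * a i) g := by
  induction g using MvPolynomial.induction_on with
  | C r => simp [onLine, Polynomial.algebraMap_apply]
  | add p q hp hq => simp [hp, hq]
  | mul_X p i hp => rw [map_mul, Polynomial.eval_mul, hp, map_mul]; simp [onLine]; ring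

theorem derivative_onLine {K : Type*} [CommRing K] [Algebra ℝ K] (w : σ → K) (a : σ → ℝ)
    (g : MvPolynomial σ ℝ) :
    Polynomial.derivative (onLine w (fun i => algebraMap ℝ K (a i)) g) =
      onLine w (fun i => algebraMap ℝ K (a i)) (directionalDeriv a g) := by
  induction g using MvPolynomial.induction_on with
  | C r => simp [onLine, directionalDeriv, Polynomial.algebraMap_apply]
  | add p q hp hq => simp [hp, hq]
  | mul_X p i hp =>
    have hX : directionalDeriv a (X i) = C (a i) := by simp [directionalDeriv]
    have hx : Polynomial.derivative (onLine w (fun i => algebraMap ℝ K (a i)) (X i)) =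
        onLine w (fun i => algebraMap ℝ K (a i)) (C (a i)) := by
      simp [onLine, Polynomial.algebraMap_apply]
    rw [map_mul, Polynomial.derivative_mul, hp, hx, Derivation.leibniz, hX]
    simp only [smul_eq_mul, map_add, map_mul]
    ring

theorem map_onLine (w a : σ → ℝ) (g : MvPolynomial σ ℝ) :
    (onLine w a g).map (algebraMap ℝ ℂ) =
      onLine (fun i => (w i : ℂ)) (fun i => (a i : ℂ)) g := by
  induction g using MvPolynomial.induction_on with
  | C r => simp [onLine, Polynomial.algebraMap_apply]
  | add p q hp hq => simp [hp, hq]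
  | mul_X p i hp => rw [map_mul, Polynomial.map_mul, hp, map_mul]; simp [onLine]

theorem aeval_const_mul_of_isHomogeneous {K : Type*} [CommRing K] [Algebra ℝ K]
    {g : MvPolynomial σ ℝ} {m : ℕ} (hg : g.IsHomogeneous m) (s : K) (w : σ → K) :
    aeval (fun i => s * w i) g = s ^ m * aeval w g := by
  rw [aeval_def, aeval_def, eval₂_eq, eval₂_eq, Finset.mul_sum]
  refine Finset.sum_congr rfl fun d hd => ?_
  have hdm := hg.degree_eq_sum_deg_support hd
  simp only [mul_pow, Finset.prod_mul_distrib, Finset.prod_pow_eq_pow_sum, ← hdm]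
  ring

/-- A real polynomial is half-plane stable if it has no zero all of whose coordinates lie in the
open right half-plane. -/
def HalfPlaneStable (g : MvPolynomial σ ℝ) : Prop :=
  ∀ w : σ → ℂ, (∀ i, 0 < (w i).re) → aeval w g ≠ 0

theorem HalfPlaneStable.of_C_mul {c : ℝ} {g : MvPolynomial σ ℝ}
    (hg : HalfPlaneStable (C c * g)) : HalfPlaneStable g := by
  intro w hw h
  exact hg w hw (by rw [map_mul, h, mul_zero])

theorem HalfPlaneStable.directionalDeriv {g : MvPolynomial σ ℝ} {m : ℕ} (hm : m ≠ 0)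
    (hg : HalfPlaneStable g) (hom : g.IsHomogeneous m) {a : σ → ℝ} (ha : ∀ i, 0 < a i) :
    HalfPlaneStable (directionalDeriv a g) := by
  intro w hw h
  set f := onLine w (fun i => algebraMap ℝ ℂ (a i)) g with hf
  have hroot : ∀ z : ℂ, 0 ≤ z.re → f.eval z ≠ 0 := by
    intro z hz
    rw [hf, eval_onLine]
    refine hg _ fun i => ?_
    have := mul_nonneg hz (ha i).le
    simpa using add_pos_of_pos_of_nonneg (hw i) this
  have hf' : f.derivative.eval 0 = 0 := by
    rw [hf, derivative_onLine, eval_onLine]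
    simpa using h
  have hne : f.derivative ≠ 0 := by
    intro h0
    have hfc := Polynomial.eq_C_of_derivative_eq_zero h0
    set c := f.coeff 0
    have key : Polynomial.X * onLine (fun i => algebraMap ℝ ℂ (a i)) w g =
        Polynomial.X * (Polynomial.C c * Polynomial.X ^ m) := by
      refine Polynomial.funext fun s => ?_
      by_cases hs : s = 0
      · simp [hs]
      have h1 : f.eval s⁻¹ = c := by rw [hfc, Polynomial.eval_C]
      rw [hf, eval_onLine] at h1
      have h2 := aeval_const_mul_of_isHomogeneous hom s (fun i => w i + s⁻¹ * algebraMap ℝ ℂ (a i))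
      rw [h1] at h2
      rw [Polynomial.eval_mul, eval_onLine, Polynomial.eval_X]
      have h3 : (fun i => s * (w i + s⁻¹ * algebraMap ℝ ℂ (a i))) =
          fun i => algebraMap ℝ ℂ (a i) + s * w i := by
        ext i; field_simp; ring
      rw [h3] at h2
      rw [h2]
      simp only [Polynomial.eval_mul, Polynomial.eval_X, Polynomial.eval_C, Polynomial.eval_pow]
      ring
    have key' := congrArg (Polynomial.eval 0) (mul_left_cancel₀ Polynomial.X_ne_zero key)
    rw [eval_onLine] at key'
    simp only [zero_mul, add_zero, Polynomial.eval_mul, Polynomial.eval_C, Polynomial.eval_pow,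
      Polynomial.eval_X, zero_pow hm, mul_zero] at key'
    exact hg (fun i => algebraMap ℝ ℂ (a i)) (fun i => by simpa using ha i) key'
  have hdeg : 0 < f.degree := by
    by_contra hd
    rw [Polynomial.eq_C_of_degree_le_zero (not_lt.mp hd)] at hne
    simp at hne
  have hmem : (0 : ℂ) ∈ f.derivative.rootSet ℂ := by
    rw [Polynomial.mem_rootSet, Polynomial.coe_aeval_eq_eval]
    exact ⟨hne, hf'⟩
  have hsub : convexHull ℝ (f.rootSet ℂ) ⊆ {z : ℂ | z.re < 0} := by
    refine convexHull_min (fun z hz => ?_) (convex_halfSpace_re_lt 0)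
    rw [Polynomial.mem_rootSet, Polynomial.coe_aeval_eq_eval] at hz
    exact not_le.mp fun hz0 => hroot z hz0 hz.2
  simpa using hsub (Polynomial.rootSet_derivative_subset_convexHull_rootSet hdeg hmem)

/-- Restricted to a line with positive direction through a positive point, a homogeneous
half-plane stable polynomial has only negative real roots. -/
theorem HalfPlaneStable.eq_neg_of_isRoot_onLine {g : MvPolynomial σ ℝ} {m : ℕ}
    (hg : HalfPlaneStable g) (hom : g.IsHomogeneous m) {w a : σ → ℝ} (hw : ∀ i, 0 < w i)
    (ha : ∀ i, 0 < a i) {z : ℂ} (hz : ((onLine w a g).map (algebraMap ℝ ℂ)).IsRoot z) :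
    ∃ r : ℝ, 0 < r ∧ z = -r := by
  have hrot : ∀ ω : ℂ, 0 < ω.re → 0 ≤ (ω * z).re → False := by
    intro ω hω hωz
    rw [map_onLine, Polynomial.IsRoot.def, eval_onLine] at hz
    have h := aeval_const_mul_of_isHomogeneous hom ω (fun i => (w i : ℂ) + z * a i)
    rw [hz, mul_zero] at h
    refine hg _ (fun i => ?_) h
    have h1 : (ω * ((w i : ℂ) + z * a i)).re = ω.re * w i + (ω * z).re * a i := by
      simp; ring
    rw [h1]
    exact add_pos_of_pos_of_nonneg (mul_pos hω (hw i)) (mul_nonneg hωz (ha i).le)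
  have him : z.im = 0 := by
    by_contra him
    refine hrot ⟨1, z.re / z.im⟩ (by simp) ?_
    simp [him]
  have hre : z.re < 0 := not_le.mp fun h => hrot 1 (by simp) (by simpa using h)
  refine ⟨-z.re, by linarith, ?_⟩
  apply Complex.ext <;> simp [him]

end MvPolynomial

/-- AM-GM for one factor against a power. -/
theorem mul_pow_le_weighted_mean_pow {u v : ℝ} (hu : 0 ≤ u) (hv : 0 < v) (N : ℕ) :
    u * v ^ N ≤ ((u + N * v) / (N + 1)) ^ (N + 1) := by
  have hN : (0 : ℝ) < N + 1 := by positivity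
  have h := one_add_mul_le_pow (a := (u / v - 1) / (N + 1)) (n := N + 1) (by
    rw [le_div_iff₀ hN]
    have := div_nonneg hu hv.le
    nlinarith [Nat.cast_nonneg (α := ℝ) N])
  have h2 : (u + N * v) / (N + 1) = v * (1 + (u / v - 1) / (N + 1)) := by
    field_simp; ring
  rw [h2, mul_pow]
  calc u * v ^ N = v ^ (N + 1) * (1 + ((N + 1 : ℕ) : ℝ) * ((u / v - 1) / (N + 1))) := by
        push_cast; field_simp; ring
    _ ≤ _ := mul_le_mul_of_nonneg_left h (by positivity)

namespace Polynomial

/-- If all complex roots of a real polynomial `f` are negative reals, then `f` is bounded above by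
the power of a linear function with the same value and derivative at `0`. -/
theorem eval_le_of_roots_neg (N : ℕ) : ∀ f : ℝ[X], f.natDegree ≤ N → 0 < f.eval 0 →
    (∀ z : ℂ, (f.map (algebraMap ℝ ℂ)).IsRoot z → ∃ r : ℝ, 0 < r ∧ z = -r) →
    0 ≤ f.derivative.eval 0 ∧ ∀ t : ℝ, 0 ≤ t →
      f.eval t ≤ f.eval 0 * (1 + t * (f.derivative.eval 0 / (N * f.eval 0))) ^ N := by
  induction N with
  | zero =>
    intro f hdeg _ _
    rw [eq_C_of_natDegree_le_zero hdeg]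
    simp
  | succ N ih =>
    intro f hdeg h0 hroots
    rcases Nat.eq_zero_or_pos f.natDegree with hf0 | hf0
    · rw [eq_C_of_natDegree_eq_zero hf0]
      simp
    obtain ⟨z, hz⟩ := IsAlgClosed.exists_root (f.map (algebraMap ℝ ℂ)) (by
      rw [degree_map]
      exact (natDegree_pos_iff_degree_pos.mp hf0).ne')
    obtain ⟨r, hr, rfl⟩ := hroots z hz
    have hfr : f.IsRoot (-r) := by
      have := hz
      rw [IsRoot.def, ← Complex.ofReal_neg, ← Complex.coe_algebraMap, eval_map_apply] at this
      simpa using this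
    obtain ⟨h, rfl⟩ := dvd_iff_isRoot.mpr hfr
    have hh : h ≠ 0 := by rintro rfl; simp at h0
    rw [natDegree_mul (X_sub_C_ne_zero _) hh, natDegree_X_sub_C] at hdeg
    have hh0 : 0 < h.eval 0 := by
      simp only [eval_mul, eval_sub, eval_X, eval_C, zero_sub, neg_neg] at h0
      exact (mul_pos_iff_of_pos_left hr).mp h0
    obtain ⟨hd, hb⟩ := ih h (by omega) hh0 (fun z hz => hroots z (by
      rw [Polynomial.map_mul, IsRoot.def, eval_mul, hz.eq_zero, mul_zero]))
    have hder : ((X - C (-r)) * h).derivative.eval 0 = h.eval 0 + r * h.derivative.eval 0 := by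
      simp [derivative_mul]
    refine ⟨by rw [hder]; positivity, fun t ht => ?_⟩
    rw [hder]
    simp only [eval_mul, eval_sub, eval_X, eval_C, zero_sub, neg_neg]
    set b := h.derivative.eval 0
    set c := h.eval 0
    have hN0 : N = 0 → b = 0 := fun hN => by
      have : h.natDegree = 0 := by omega
      rw [show b = h.derivative.eval 0 from rfl, eq_C_of_natDegree_eq_zero this]
      simp
    have hv : 0 < 1 + t * (b / (N * c)) := by positivity
    calc (t - -r) * h.eval t
        ≤ (t - -r) * (c * (1 + t * (b / (N * c))) ^ N) :=
          mul_le_mul_of_nonneg_left (hb t ht) (by linarith)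
      _ = r * c * ((1 + t / r) * (1 + t * (b / (N * c))) ^ N) := by field_simp; ring
      _ ≤ r * c * ((1 + t / r + N * (1 + t * (b / (N * c)))) / (N + 1)) ^ (N + 1) :=
          mul_le_mul_of_nonneg_left (mul_pow_le_weighted_mean_pow (by positivity) hv N)
            (by positivity)
      _ = _ := by
          congr 2
          rcases Nat.eq_zero_or_pos N with hN | hN
          · rw [hN0 hN, hN]; push_cast; field_simp; ring
          · push_cast; field_simp; ring

/-- If `f` lies above the line `t ↦ c t` on the positive axis then `f.derivative.eval 0` is at
least `(k / (k + 1)) ^ k * c`. -/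
theorem le_derivative_eval_zero_of_roots_neg {k : ℕ} (hk : k ≠ 0) {f : ℝ[X]}
    (hdeg : f.natDegree ≤ k + 1) (h0 : 0 < f.eval 0)
    (hroots : ∀ z : ℂ, (f.map (algebraMap ℝ ℂ)).IsRoot z → ∃ r : ℝ, 0 < r ∧ z = -r)
    {c : ℝ} (hc : 0 ≤ c) (hf : ∀ t : ℝ, 0 < t → c * t ≤ f.eval t) :
    ((k : ℝ) / (k + 1)) ^ k * c ≤ f.derivative.eval 0 := by
  obtain ⟨hd, hb⟩ := eval_le_of_roots_neg (k + 1) f hdeg h0 hroots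
  set d := f.derivative.eval 0
  set e := f.eval 0
  have hk' : (0 : ℝ) < k := by positivity
  rcases hd.eq_or_lt with hd | hd
  · rw [← hd] at hb ⊢
    rcases hc.eq_or_lt with hc | hc
    · simp [← hc]
    have ht : 0 < (e + 1) / c := by positivity
    have h1 := (hf _ ht).trans (hb _ ht.le)
    rw [mul_div_cancel₀ _ hc.ne'] at h1
    simp at h1
    linarith
  · have ht : 0 < (k + 1) * e / (k * d) := by positivity
    have h1 := (hf _ ht).trans (hb _ ht.le)
    have h2 : 1 + (k + 1) * e / (k * d) * (d / (((k + 1 : ℕ) : ℝ) * e)) = (k + 1) / k := by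
      push_cast; field_simp
    rw [h2, pow_succ] at h1
    have h3 : c ≤ ((k + 1) / k : ℝ) ^ k * d := by
      have h4 : 0 < (k + 1) * e / k := by positivity
      have h5 : c * ((k + 1) * e / (k * d)) = (k + 1) * e / k * (c / d) := by field_simp
      have h6 : e * (((k + 1 : ℝ) / k) ^ k * ((k + 1) / k)) =
        (k + 1) * e / k * ((k + 1 : ℝ) / k) ^ k := by ring
      rw [h5, h6] at h1
      exact (div_le_iff₀ hd).mp (le_of_mul_le_mul_left h1 h4)
    calc ((k : ℝ) / (k + 1)) ^ k * c ≤ (k / (k + 1)) ^ k * (((k + 1) / k) ^ k * d) := by gcongr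
      _ = ((k / (k + 1) : ℝ) * ((k + 1) / k)) ^ k * d := by rw [mul_pow]; ring
      _ = d := by
        rw [show (k / (k + 1) : ℝ) * ((k + 1) / k) = 1 by field_simp]; simp

end Polynomial

theorem Derivation.map_finset_prod {R A M ι : Type*} [CommSemiring R] [CommSemiring A]
    [AddCommMonoid M] [Algebra R A] [Module A M] [Module R M] [DecidableEq ι]
    (D : Derivation R A M) (s : Finset ι) (f : ι → A) :
    D (∏ i ∈ s, f i) = ∑ i ∈ s, (∏ j ∈ s.erase i, f j) • D (f i) := by
  induction s using Finset.induction_on with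
  | empty => simp
  | insert a s ha ih =>
    rw [Finset.prod_insert ha, D.leibniz, ih, Finset.sum_insert ha, Finset.erase_insert ha,
      add_comm, Finset.smul_sum]
    congr 1
    refine Finset.sum_congr rfl fun i hi => ?_
    have hia : a ≠ i := by rintro rfl; exact ha hi
    rw [Finset.erase_insert_of_ne hia, Finset.prod_insert (by simp [ha]), mul_smul]

section Permanent

open MvPolynomial

variable {n : ℕ}

/-- The permanent of the matrix obtained from `A` by replacing its first `k` rows by the row of
indeterminates. -/
noncomputable def partialPermanent (A : Matrix (Fin n) (Fin n) ℝ) (k : ℕ) :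
    MvPolynomial (Fin n) ℝ :=
  ∑ σ : Equiv.Perm (Fin n), ∏ j : Fin n, if (j : ℕ) < k then X (σ j) else C (A j (σ j))

theorem eval_partialPermanent (A : Matrix (Fin n) (Fin n) ℝ) (k : ℕ) (y : Fin n → ℝ) :
    eval y (partialPermanent A k) =
      ∑ σ : Equiv.Perm (Fin n), ∏ j : Fin n, if (j : ℕ) < k then y (σ j) else A j (σ j) := by
  simp only [partialPermanent, map_sum, map_prod]
  refine Finset.sum_congr rfl fun σ _ => Finset.prod_congr rfl fun j _ => ?_
  split_ifs <;> simp

theorem partialPermanent_isHomogeneous (A : Matrix (Fin n) (Fin n) ℝ) {k : ℕ} (hk : k ≤ n) :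
    (partialPermanent A k).IsHomogeneous k := by
  refine IsHomogeneous.sum _ _ _ fun σ _ => ?_
  have h := IsHomogeneous.prod Finset.univ
    (fun j : Fin n => if (j : ℕ) < k then (X (σ j) : MvPolynomial (Fin n) ℝ) else C (A j (σ j)))
    (fun j => if (j : ℕ) < k then 1 else 0) (fun j _ => by
      split_ifs
      · exact isHomogeneous_X _ _
      · exact isHomogeneous_C _ _)
  convert h
  rw [Finset.sum_boole, Fin.card_filter_val_lt]
  simp [hk]

theorem eval_partialPermanent_pos {A : Matrix (Fin n) (Fin n) ℝ} (hA : ∀ i j, 0 < A i j) (k : ℕ)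
    {y : Fin n → ℝ} (hy : ∀ i, 0 < y i) : 0 < eval y (partialPermanent A k) := by
  rw [eval_partialPermanent]
  refine Finset.sum_pos (fun σ _ => Finset.prod_pos fun j _ => ?_) Finset.univ_nonempty
  split_ifs
  · exact hy _
  · exact hA _ _

theorem partialPermanent_self (A : Matrix (Fin n) (Fin n) ℝ) :
    partialPermanent A n = C (n.factorial : ℝ) * ∏ i, X i := by
  simp only [partialPermanent, Fin.is_lt, if_true]
  rw [Finset.sum_congr rfl fun σ _ => Equiv.prod_comp σ fun i => X i]
  simp [Fintype.card_perm]

/-- Differentiating the partial permanent in the direction of the next row. -/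
theorem directionalDeriv_partialPermanent (A : Matrix (Fin n) (Fin n) ℝ) (k : Fin n) :
    directionalDeriv (A k) (partialPermanent A (k + 1)) =
      C ((k : ℝ) + 1) * partialPermanent A k := by
  have hterm : ∀ j : Fin n, (∑ σ : Equiv.Perm (Fin n),
      (∏ l ∈ univ.erase j, if (l : ℕ) < k + 1 then (X (σ l) : MvPolynomial (Fin n) ℝ)
        else C (A l (σ l))) •
      directionalDeriv (A k) (if (j : ℕ) < k + 1 then X (σ j) else C (A j (σ j)))) =
      if (j : ℕ) < k + 1 then partialPermanent A k else 0 := by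
    intro j
    split_ifs with hj
    · rw [partialPermanent, ← Equiv.sum_comp (Equiv.mulRight (Equiv.swap j k))
        fun σ => ∏ l : Fin n, if (l : ℕ) < k then X (σ l) else C (A l (σ l))]
      refine Finset.sum_congr rfl fun σ _ => ?_
      rw [← Equiv.prod_comp (Equiv.swap j k) fun l => if (l : ℕ) < k then
          (X ((Equiv.mulRight (Equiv.swap j k) σ) l) : MvPolynomial (Fin n) ℝ)
          else C (A l ((Equiv.mulRight (Equiv.swap j k) σ) l)),
        ← Finset.mul_prod_erase _ _ (mem_univ j), mul_comm]
      simp only [Equiv.coe_mulRight, Equiv.Perm.mul_apply, Equiv.swap_apply_self, smul_eq_mul,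
        Equiv.swap_apply_left, lt_self_iff_false, if_false]
      congr 1
      · refine Finset.prod_congr rfl fun l hl => ?_
        have hlj := Finset.ne_of_mem_erase hl
        by_cases hlk : l = k
        · subst hlk
          have : (j : ℕ) < l := by
            have := Fin.val_ne_of_ne hlj
            omega
          simp [this]
        · rw [Equiv.swap_apply_of_ne_of_ne hlj hlk]
          have := Fin.val_ne_of_ne hlk
          have : (l : ℕ) < k + 1 ↔ (l : ℕ) < k := by omega
          simp [this]
      · simp [directionalDeriv]
    · simp [directionalDeriv]
  rw [partialPermanent, map_sum]
  simp only [Derivation.map_finset_prod]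
  rw [Finset.sum_comm, Finset.sum_congr rfl fun j _ => hterm j, ← Finset.sum_filter,
    Finset.sum_const, Fin.card_filter_val_lt, min_eq_right (by omega), nsmul_eq_mul]
  simp

theorem partialPermanent_halfPlaneStable {A : Matrix (Fin n) (Fin n) ℝ}
    (hA : ∀ i j, 0 < A i j) {k : ℕ} (hk : k ≤ n) : HalfPlaneStable (partialPermanent A k) := by
  induction hk using Nat.decreasingInduction with
  | self =>
    intro w hw
    rw [partialPermanent_self, map_mul, map_prod]
    refine mul_ne_zero ?_ (Finset.prod_ne_zero_iff.mpr fun i _ h => ?_)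
    · simp [Nat.factorial_ne_zero]
    · have := hw i
      rw [aeval_X] at h
      simp [h] at this
  | of_succ k hk ih =>
    have h := ih.directionalDeriv k.succ_ne_zero (partialPermanent_isHomogeneous A hk)
      (hA ⟨k, hk⟩)
    rw [directionalDeriv_partialPermanent A ⟨k, hk⟩] at h
    exact h.of_C_mul

theorem prod_le_prod_weighted_sum {A : Matrix (Fin n) (Fin n) ℝ} (hA : ∀ i j, 0 ≤ A i j)
    (hrow : ∀ i, ∑ j, A i j = 1) (hcol : ∀ j, ∑ i, A i j = 1) {x : Fin n → ℝ}
    (hx : ∀ j, 0 < x j) : ∏ j, x j ≤ ∏ i, ∑ j, x j * A j i := by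
  calc ∏ j, x j = ∏ j, x j ^ (∑ i, A j i) := by simp [hrow]
    _ = ∏ i, ∏ j, x j ^ A j i := by
      rw [Finset.prod_comm]
      exact Finset.prod_congr rfl fun j _ => Real.rpow_sum_of_pos (hx j) _ _
    _ ≤ _ := by
      refine Finset.prod_le_prod (fun i _ => Finset.prod_nonneg fun j _ =>
        Real.rpow_nonneg (hx j).le _) fun i _ => ?_
      simp only [mul_comm (x _)]
      exact Real.geom_mean_le_arith_mean_weighted _ _ _ (fun j _ => hA j i) (hcol i)
        fun j _ => (hx j).le

/-- Gurvits' capacity bound for the partial permanents. -/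
theorem capacity_partialPermanent_ge {A : Matrix (Fin n) (Fin n) ℝ} (hA : ∀ i j, 0 < A i j)
    (hrow : ∀ i, ∑ j, A i j = 1) (hcol : ∀ j, ∑ i, A i j = 1) {k : ℕ} (hk : k ≤ n) (hk0 : k ≠ 0)
    {x : Fin n → ℝ} (hx : ∀ j, 0 < x j) :
    (n.factorial : ℝ) / (n : ℝ) ^ n * (k : ℝ) ^ k * ∏ j with j.val < k, x j ≤
      eval (fun i => ∑ j with j.val < k, x j * A j i) (partialPermanent A k) := by
  induction hk using Nat.decreasingInduction generalizing x with
  | self =>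
    have hn : (n : ℝ) ≠ 0 := by exact_mod_cast hk0
    rw [partialPermanent_self, div_mul_cancel₀ _ (pow_ne_zero _ hn)]
    simp only [Fin.is_lt, Finset.filter_true, map_mul, eval_C, map_prod, eval_X]
    exact mul_le_mul_of_nonneg_left
      (prod_le_prod_weighted_sum (fun i j => (hA i j).le) hrow hcol hx) (Nat.cast_nonneg _)
  | of_succ k hk ih =>
    set κ : Fin n := ⟨k, hk⟩
    set y : Fin n → ℝ := fun i => ∑ j with j.val < k, x j * A j i with hy
    have hins : (univ.filter fun j : Fin n => j.val < k + 1) =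
        insert κ (univ.filter fun j : Fin n => j.val < k) := by
      ext j
      simp [κ, Fin.ext_iff]
      omega
    have hnot : κ ∉ univ.filter fun j : Fin n => j.val < k := by simp [κ]
    have hypos : ∀ i, 0 < y i := fun i =>
      Finset.sum_pos (fun j _ => mul_pos (hx j) (hA j i))
        ⟨⟨0, by omega⟩, by simpa using Nat.pos_of_ne_zero hk0⟩
    have hhom := partialPermanent_isHomogeneous A (k := k + 1) hk
    have hstab := partialPermanent_halfPlaneStable hA (k := k + 1) hk
    set f := onLine y (A κ) (partialPermanent A (k + 1)) with hf
    have hf_eval : ∀ t, f.eval t = eval (fun i => y i + t * A κ i) (partialPermanent A (k + 1)) :=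
      fun t => by rw [hf, eval_onLine, ← coe_aeval_eq_eval]; rfl
    have hder : f.derivative.eval 0 = (k + 1) * eval y (partialPermanent A k) := by
      have h1 := derivative_onLine y (A κ) (partialPermanent A (k + 1))
      simp only [Algebra.algebraMap_self, RingHom.id_apply] at h1
      rw [hf, h1, directionalDeriv_partialPermanent A κ, eval_onLine]
      simp [κ, aeval_eq_eval]
    have hdeg : f.natDegree ≤ k + 1 := by
      have : f.natDegree ≤ (k + 1) * 1 := aeval_natDegree_le (partialPermanent A (k + 1)) hhom.totalDegree_le
        (fun i => Polynomial.C (y i) + Polynomial.X * Polynomial.C (A κ i)) (n := 1)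
        (fun i => by compute_degree)
      omega
    have h0 : 0 < f.eval 0 := by
      rw [hf_eval]
      exact eval_partialPermanent_pos hA _ fun i => by simpa using hypos i
    set c := (n.factorial : ℝ) / (n : ℝ) ^ n * ((k + 1 : ℕ) : ℝ) ^ (k + 1) *
      ∏ j with j.val < k, x j with hc
    have hcpos : 0 ≤ c := mul_nonneg (by positivity) (Finset.prod_nonneg fun j _ => (hx j).le)
    have hlow : ∀ t : ℝ, 0 < t → c * t ≤ f.eval t := by
      intro t ht
      have h := ih k.succ_ne_zero (x := Function.update x κ t) (fun j => by
        by_cases hj : j = κ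
        · simp [hj, ht]
        · simp [hj, hx j])
      have hne : ∀ j ∈ univ.filter (fun j : Fin n => j.val < k), Function.update x κ t j = x j :=
        fun j hj => Function.update_of_ne (ne_of_mem_of_not_mem hj hnot) _ _
      rw [hins, Finset.prod_insert hnot, Finset.prod_congr rfl hne] at h
      simp only [Finset.sum_insert hnot, Function.update_self] at h
      have hsum : ∀ i, ∑ j with j.val < k, Function.update x κ t j * A j i = y i := fun i =>
        Finset.sum_congr rfl fun j hj => by rw [hne j hj]
      simp only [hsum] at h
      rw [hf_eval]
      simp only [add_comm (y _)]
      refine le_trans (le_of_eq ?_) h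
      rw [hc]; ring
    have hmain := Polynomial.le_derivative_eval_zero_of_roots_neg hk0 hdeg h0
      (fun z hz => hstab.eq_neg_of_isRoot_onLine hhom hypos (hA κ) hz) hcpos hlow
    rw [hder] at hmain
    have hk1 : (0 : ℝ) < k + 1 := by positivity
    refine le_of_mul_le_mul_left (le_trans (le_of_eq ?_) hmain) hk1
    rw [hc, div_pow]
    push_cast
    field_simp
    ring

theorem permanent_ge_of_pos (hn : n ≠ 0) {A : Matrix (Fin n) (Fin n) ℝ} (hA : ∀ i j, 0 < A i j)
    (hrow : ∀ i, ∑ j, A i j = 1) (hcol : ∀ j, ∑ i, A i j = 1) :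
    (n.factorial : ℝ) / (n : ℝ) ^ n ≤ permanent A := by
  have h := capacity_partialPermanent_ge hA hrow hcol (k := 1) (by omega) one_ne_zero
    (x := fun _ => 1) fun _ => one_pos
  have hfil : (univ.filter fun j : Fin n => j.val < 1) = {⟨0, by omega⟩} := by
    ext j
    simp [Fin.ext_iff]
  rw [hfil, eval_partialPermanent] at h
  simp only [Nat.cast_one, one_pow, mul_one, Finset.prod_const_one, Finset.sum_singleton,
    one_mul] at h
  refine h.trans (le_of_eq ?_)
  refine Finset.sum_congr rfl fun σ _ => Finset.prod_congr rfl fun j _ => ?_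
  split_ifs with hj
  · have hj0 : (⟨0, by omega⟩ : Fin n) = j := Fin.ext (by simp; omega)
    rw [hj0]
  · rfl

end Permanent

/-- Egorychev–Falikman theorem (van der Waerden conjecture): the permanent of any `n × n`
doubly stochastic matrix is at least `n!/n^n`. -/
theorem permanent_doublyStochastic_ge (n : ℕ) (A : Matrix (Fin n) (Fin n) ℝ)
    (hnonneg : ∀ i j, 0 ≤ A i j)
    (hrow : ∀ i, ∑ j, A i j = 1)
    (hcol : ∀ j, ∑ i, A i j = 1) :
    (Nat.factorial n : ℝ) / (n : ℝ) ^ n ≤ permanent A := by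
  rcases Nat.eq_zero_or_pos n with rfl | hn
  · simp [permanent]
  have hn' : (0 : ℝ) < n := by exact_mod_cast hn
  let B : ℝ → Matrix (Fin n) (Fin n) ℝ := fun ε i j => (1 - ε) * A i j + ε * (n : ℝ)⁻¹
  have hcont : Continuous fun ε => permanent (B ε) := by
    unfold permanent
    fun_prop
  have hlim : Filter.Tendsto (fun ε => permanent (B ε)) (nhdsWithin 0 (Set.Ioi 0))
      (nhds (permanent A)) := by
    have h0 : permanent (B 0) = permanent A := by simp [B, permanent]
    rw [← h0]
    exact hcont.continuousAt.tendsto.mono_left nhdsWithin_le_nhds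
  refine ge_of_tendsto hlim ?_
  filter_upwards [Ioo_mem_nhdsGT (zero_lt_one' ℝ)] with ε hε
  refine permanent_ge_of_pos hn.ne' (fun i j => ?_) (fun i => ?_) (fun j => ?_)
  · exact add_pos_of_nonneg_of_pos (mul_nonneg (by linarith [hε.2]) (hnonneg i j))
      (mul_pos hε.1 (inv_pos.mpr hn'))
  · simp only [B, Finset.sum_add_distrib, ← Finset.mul_sum, hrow]
    simp [hn'.ne']
  · simp only [B, Finset.sum_add_distrib, ← Finset.mul_sum, hcol]
    simp [hn'.ne']
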